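/- arXiv:2509.07380 — 5 statements merged into one kernel-verified Lean document; each statement's English description precedes it below -/
import Mathlib

section
/- Fix M > 0. There exists a constant ν₁ > 0 depending only on M such that for every admissible closed-curve data (g, κ) satisfying the closure constraint ∫₀¹ κ(s) g(s) ds = 2π and the length bound ∫₀¹ g(s) ds ≤ M, and for every 1-periodic C¹ function u : ℝ → ℝ, the quadratic form of the Helmholtz operator is H¹-coercive: ∫₀¹ ( u′(s)²/g(s) + κ(s)² u(s)² g(s) ) ds ≥ ν₁ ∫₀¹ ( u′(s)²/g(s) + u(s)² g(s) ) ds. -/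
open MeasureTheory Real

/-- The oscillation of a `C¹` function on `[0, 1]` is at most the total variation `∫₀¹ |u′|`. -/
theorem abs_sub_le_integral_abs_deriv {u : ℝ → ℝ} (hu : ContDiff ℝ 1 u) {s t : ℝ}
    (hs : s ∈ Set.Icc (0 : ℝ) 1) (ht : t ∈ Set.Icc (0 : ℝ) 1) :
    |u t - u s| ≤ ∫ x in (0:ℝ)..1, |deriv u x| := by
  have hc : Continuous (deriv u) := hu.continuous_deriv le_rfl
  rw [← intervalIntegral.integral_deriv_eq_sub
    (fun x _ => (hu.differentiable one_ne_zero).differentiableAt) (hc.intervalIntegrable s t)]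
  have hmono := intervalIntegral.abs_integral_mono_interval (f := fun x => |deriv u x|)
    (μ := volume) (a := s) (b := t) (c := 0) (d := 1)
    (Set.uIoc_subset_uIoc_of_uIcc_subset_uIcc (Set.uIcc_subset_uIcc (by simpa [Set.uIcc_of_le] using hs) (by simpa [Set.uIcc_of_le] using ht)))
    (Filter.Eventually.of_forall fun x => abs_nonneg _) (hc.abs.intervalIntegrable 0 1)
  calc |∫ x in s..t, deriv u x| ≤ |∫ x in s..t, (|deriv u x|)| := by
        simpa using intervalIntegral.norm_integral_le_abs_integral_norm (f := deriv u)
          (μ := volume) (a := s) (b := t)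
    _ ≤ |∫ x in (0:ℝ)..1, (|deriv u x|)| := hmono
    _ = _ := abs_of_nonneg (intervalIntegral.integral_nonneg zero_le_one fun x _ => abs_nonneg _)

/-- Weighted Cauchy-Schwarz inequality: `(∫₀¹ |v|)² ≤ M ∫₀¹ v²/g` when `∫₀¹ g ≤ M`. -/
theorem sq_integral_abs_le {M : ℝ} (hM : 0 < M) {g v : ℝ → ℝ} (hg : Continuous g)
    (hv : Continuous v) (hpos : ∀ s, 0 < g s) (hL : (∫ s in (0:ℝ)..1, g s) ≤ M) :
    (∫ s in (0:ℝ)..1, |v s|) ^ 2 ≤ M * ∫ s in (0:ℝ)..1, v s ^ 2 / g s := by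
  set I := ∫ s in (0:ℝ)..1, |v s|
  have hD : Continuous fun s => v s ^ 2 / g s := (hv.pow 2).div hg fun s => (hpos s).ne'
  have key : (∫ s in (0:ℝ)..1, 2 * (I / M) * |v s| - (I / M) ^ 2 * g s) ≤
      ∫ s in (0:ℝ)..1, v s ^ 2 / g s := by
    refine intervalIntegral.integral_mono_on zero_le_one
      (Continuous.intervalIntegrable (by fun_prop) _ _) (hD.intervalIntegrable _ _) fun s _ => ?_
    rw [le_div_iff₀ (hpos s), ← sq_abs (v s)]
    nlinarith [sq_nonneg (|v s| - I / M * g s)]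
  rw [intervalIntegral.integral_sub (Continuous.intervalIntegrable (by fun_prop) _ _)
    (Continuous.intervalIntegrable (by fun_prop) _ _), intervalIntegral.integral_const_mul,
    intervalIntegral.integral_const_mul] at key
  have h1 := mul_le_mul_of_nonneg_left hL (sq_nonneg (I / M))
  have h2 : M * (2 * (I / M) * I - (I / M) ^ 2 * M) = I ^ 2 := by field_simp; ring
  rw [← h2]
  exact mul_le_mul_of_nonneg_left (by linarith) hM.le

/-- If `m ≤ u²` on `[0, 1]`, the total curvature bounds `m` by the curvature term of the form. -/
theorem le_mul_integral_curvature {M : ℝ} (hM : 0 < M) {g κ u : ℝ → ℝ} (hg : Continuous g)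
    (hκ : Continuous κ) (hu : Continuous u) (hpos : ∀ s, 0 < g s)
    (hclosed : (∫ s in (0:ℝ)..1, κ s * g s) = 2 * π) (hL : (∫ s in (0:ℝ)..1, g s) ≤ M)
    {m : ℝ} (hm : 0 ≤ m) (hmu : ∀ s ∈ Set.Icc (0 : ℝ) 1, m ≤ u s ^ 2) :
    m ≤ M * ∫ s in (0:ℝ)..1, κ s ^ 2 * u s ^ 2 * g s := by
  have key : (∫ s in (0:ℝ)..1, 2 * m / M * (κ s * g s) - m / M ^ 2 * g s) ≤
      ∫ s in (0:ℝ)..1, κ s ^ 2 * u s ^ 2 * g s := by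
    refine intervalIntegral.integral_mono_on zero_le_one
      (Continuous.intervalIntegrable (by fun_prop) _ _)
      (Continuous.intervalIntegrable (by fun_prop) _ _) fun s hs => ?_
    calc 2 * m / M * (κ s * g s) - m / M ^ 2 * g s
        = m * κ s ^ 2 * g s - m * (κ s - 1 / M) ^ 2 * g s := by field_simp; ring
      _ ≤ m * κ s ^ 2 * g s := sub_le_self _ (by have := hpos s; positivity)
      _ ≤ u s ^ 2 * κ s ^ 2 * g s := by have := hpos s; gcongr; exact hmu s hs
      _ = _ := by ring
  rw [intervalIntegral.integral_sub (Continuous.intervalIntegrable (by fun_prop) _ _)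
    (Continuous.intervalIntegrable (by fun_prop) _ _), intervalIntegral.integral_const_mul,
    intervalIntegral.integral_const_mul, hclosed] at key
  have h1 : m / M ^ 2 * (∫ s in (0:ℝ)..1, g s) ≤ m / M ^ 2 * M := by gcongr
  have h2 : M * (2 * m / M * (2 * π) - m / M ^ 2 * M) = m * (4 * π - 1) := by field_simp; ring
  calc m ≤ m * (4 * π - 1) := le_mul_of_one_le_right hm (by linarith [pi_gt_three])
    _ = _ := h2.symm
    _ ≤ _ := mul_le_mul_of_nonneg_left (by linarith) hM.le

/-- **H¹ coercivity of the Helmholtz operator.**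
For every `M > 0` there is `ν₁ > 0`, depending only on `M`, such that for all admissible
closed-curve data `(g, κ)` (1-periodic, `g` continuous and positive, `κ` continuous,
closure constraint `∫₀¹ κ g = 2π`, length bound `∫₀¹ g ≤ M`) and every 1-periodic `C¹`
function `u`, the quadratic form `⟨H u, u⟩ = ∫₀¹ (u′²/g + κ²u²g)` dominates
`ν₁ ‖u‖²_{H¹} = ν₁ ∫₀¹ (u′²/g + u²g)`. -/
theorem helmholtz_H1_coercive (M : ℝ) (hM : 0 < M) :
    ∃ ν₁ : ℝ, 0 < ν₁ ∧
      ∀ g κ : ℝ → ℝ,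
        Function.Periodic g 1 → Function.Periodic κ 1 →
        Continuous g → Continuous κ → (∀ s, 0 < g s) →
        (∫ s in (0:ℝ)..1, κ s * g s) = 2 * π →
        (∫ s in (0:ℝ)..1, g s) ≤ M →
        ∀ u : ℝ → ℝ, Function.Periodic u 1 → ContDiff ℝ 1 u →
          ν₁ * ∫ s in (0:ℝ)..1, ((deriv u s) ^ 2 / g s + (u s) ^ 2 * g s) ≤
            ∫ s in (0:ℝ)..1, ((deriv u s) ^ 2 / g s + (κ s) ^ 2 * (u s) ^ 2 * g s) := by
  refine ⟨1 / (1 + 2 * M ^ 2), by positivity, ?_⟩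
  intro g κ _ _ hg hκ hpos hclosed hL u _ hu
  have huc := hu.continuous
  have hu' : Continuous (deriv u) := hu.continuous_deriv le_rfl
  have hDc : Continuous fun s => deriv u s ^ 2 / g s := (hu'.pow 2).div hg fun s => (hpos s).ne'
  have hDi := hDc.intervalIntegrable (μ := volume) 0 1
  rw [intervalIntegral.integral_add hDi (Continuous.intervalIntegrable (by fun_prop) _ _),
    intervalIntegral.integral_add hDi (Continuous.intervalIntegrable (by fun_prop) _ _)]
  obtain ⟨s₀, hs₀, hmin⟩ := isCompact_Icc.exists_isMinOn
    (Set.nonempty_Icc.2 (zero_le_one (α := ℝ))) (huc.pow 2).continuousOn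
  have hK := le_mul_integral_curvature hM hg hκ huc hpos hclosed hL (sq_nonneg (u s₀))
    fun s hs => hmin hs
  have hD := sq_integral_abs_le hM hg hu' hpos hL
  set D := ∫ s in (0:ℝ)..1, deriv u s ^ 2 / g s
  set K := ∫ s in (0:ℝ)..1, κ s ^ 2 * u s ^ 2 * g s
  have hD0 : 0 ≤ D := intervalIntegral.integral_nonneg zero_le_one fun s _ => by
    have := hpos s; positivity
  have hK0 : 0 ≤ K := intervalIntegral.integral_nonneg zero_le_one fun s _ => by
    have := hpos s; positivity
  have hbound : ∀ t ∈ Set.Icc (0 : ℝ) 1, u t ^ 2 ≤ 2 * M * (D + K) := fun t ht => by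
    have hosc : (u t - u s₀) ^ 2 ≤ _ := sq_le_sq' (abs_le.1
      (abs_sub_le_integral_abs_deriv hu hs₀ ht)).1 (abs_le.1
      (abs_sub_le_integral_abs_deriv hu hs₀ ht)).2
    nlinarith [sq_nonneg (u t - 2 * u s₀)]
  have hL2 : (∫ s in (0:ℝ)..1, u s ^ 2 * g s) ≤ 2 * M * (D + K) * M := by
    calc (∫ s in (0:ℝ)..1, u s ^ 2 * g s) ≤ ∫ s in (0:ℝ)..1, 2 * M * (D + K) * g s :=
          intervalIntegral.integral_mono_on zero_le_one
            (Continuous.intervalIntegrable (by fun_prop) _ _)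
            (Continuous.intervalIntegrable (by fun_prop) _ _)
            fun s hs => mul_le_mul_of_nonneg_right (hbound s hs) (hpos s).le
      _ = 2 * M * (D + K) * ∫ s in (0:ℝ)..1, g s := intervalIntegral.integral_const_mul _ _
      _ ≤ _ := mul_le_mul_of_nonneg_left hL (by positivity)
  rw [one_div_mul_eq_div, div_le_iff₀ (by positivity)]
  nlinarith
end

section
/- Fix M > 0. There exists a constant ν₂ > 0 depending only on M such that the following holds. Let g be 1-periodic, C¹ and strictly positive and κ be 1-periodic and C¹, satisfying the closure constraint ∫₀¹ κ g ds = 2π, the length bound ∫₀¹ g ds ≤ M, and the curvature bound ∫₀¹ ( κ′(s)²/g(s) + κ(s)² g(s) ) ds ≤ M². Then for every 1-periodic C² function u : ℝ → ℝ, ∫₀¹ (H u)(s)² g(s) ds ≥ ν₂² ∫₀¹ ( ((∇ₛ∇ₛu)(s))² + u(s)² ) g(s) ds, where ∇ₛ∇ₛu = (1/g)((1/g)u′)′ and H u = −∇ₛ∇ₛu + κ²u; that is, ‖Hu‖_{L²(dσ)} ≥ ν₂ ‖u‖_{H²}. -/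
open MeasureTheory Real

/-- Weighted Cauchy–Schwarz inequality for continuous functions on `[0, 1]`. -/
theorem sq_integral_mul_mul_le {a b g : ℝ → ℝ} (ha : Continuous a) (hb : Continuous b)
    (hg : Continuous g) (hpos : ∀ s, 0 ≤ g s) :
    (∫ s in (0:ℝ)..1, a s * b s * g s) ^ 2 ≤
      (∫ s in (0:ℝ)..1, a s ^ 2 * g s) * ∫ s in (0:ℝ)..1, b s ^ 2 * g s := by
  have key : ∀ t : ℝ, 0 ≤ (∫ s in (0:ℝ)..1, a s ^ 2 * g s) * (t * t) +
      (2 * ∫ s in (0:ℝ)..1, a s * b s * g s) * t + ∫ s in (0:ℝ)..1, b s ^ 2 * g s := by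
    intro t
    have h : 0 ≤ ∫ s in (0:ℝ)..1, (t * a s + b s) ^ 2 * g s :=
      intervalIntegral.integral_nonneg zero_le_one
        fun s _ => mul_nonneg (sq_nonneg _) (hpos s)
    have e : (fun s => (t * a s + b s) ^ 2 * g s) =
        fun s => (t * t) * (a s ^ 2 * g s) + (2 * t) * (a s * b s * g s) + b s ^ 2 * g s := by
      funext s; ring
    rw [e, intervalIntegral.integral_add, intervalIntegral.integral_add,
      intervalIntegral.integral_const_mul, intervalIntegral.integral_const_mul] at h
    · linarith
    all_goals exact Continuous.intervalIntegrable (by fun_prop) _ _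
  have := discrim_le_zero key
  rw [discrim] at this
  nlinarith

/-- The oscillation of a `C¹` function on `[0, 1]` is at most the integral of `|h'|`. -/
theorem abs_sub_le_integral_abs_deriv_s1 {h : ℝ → ℝ} (hh : ContDiff ℝ 1 h) {x y : ℝ}
    (hx : x ∈ Set.Icc (0:ℝ) 1) (hy : y ∈ Set.Icc (0:ℝ) 1) :
    |h x - h y| ≤ ∫ s in (0:ℝ)..1, |deriv h s| := by
  have hc : Continuous (deriv h) := hh.continuous_deriv le_rfl
  wlog hyx : y ≤ x generalizing x y
  · rw [abs_sub_comm]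
    exact this hy hx (le_of_not_ge hyx)
  rw [← intervalIntegral.integral_deriv_eq_sub
    (fun s _ => (hh.differentiable one_ne_zero).differentiableAt) (hc.intervalIntegrable _ _)]
  refine (intervalIntegral.abs_integral_le_integral_abs hyx).trans ?_
  exact intervalIntegral.integral_mono_interval hy.1 hyx hx.2
    (Filter.Eventually.of_forall fun s => abs_nonneg _) (hc.abs.intervalIntegrable _ _)

/-- Integration by parts for 1-periodic `C¹` functions. -/
theorem integral_deriv_mul_eq_neg_of_periodic {u v : ℝ → ℝ} (hu : ContDiff ℝ 1 u)
    (hv : ContDiff ℝ 1 v) (pu : Function.Periodic u 1) (pv : Function.Periodic v 1) :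
    (∫ s in (0:ℝ)..1, deriv v s * u s) = -∫ s in (0:ℝ)..1, v s * deriv u s := by
  have h := intervalIntegral.integral_deriv_mul_eq_sub (a := 0) (b := 1)
    (fun s _ => (hv.differentiable one_ne_zero s).hasDerivAt)
    (fun s _ => (hu.differentiable one_ne_zero s).hasDerivAt)
    ((hv.continuous_deriv le_rfl).intervalIntegrable _ _)
    ((hu.continuous_deriv le_rfl).intervalIntegrable _ _)
  have hc := hu.continuous
  have hc' := hv.continuous
  have hd := hu.continuous_deriv le_rfl
  have hd' := hv.continuous_deriv le_rfl
  rw [intervalIntegral.integral_add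
    (Continuous.intervalIntegrable (by fun_prop) _ _)
    (Continuous.intervalIntegrable (by fun_prop) _ _), pu.eq, pv.eq] at h
  linarith

theorem Function.Periodic.deriv_periodic {u : ℝ → ℝ} {c : ℝ} (h : Function.Periodic u c) :
    Function.Periodic (deriv u) c := by
  intro x
  rw [← deriv_comp_add_const, funext h]

section Curve

variable {M : ℝ} {g κ : ℝ → ℝ}

/-- The closure constraint and the curvature bound give a lower bound on the length. -/
theorem four_pi_sq_le_mul_length (hg : Continuous g) (hκ : Continuous κ) (hpos : ∀ s, 0 < g s)
    (hclosed : (∫ s in (0:ℝ)..1, κ s * g s) = 2 * π)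
    (hcurv : (∫ s in (0:ℝ)..1, κ s ^ 2 * g s) ≤ M ^ 2) :
    4 * π ^ 2 ≤ M ^ 2 * ∫ s in (0:ℝ)..1, g s := by
  have h := sq_integral_mul_mul_le hκ (continuous_const (y := (1:ℝ))) hg fun s => (hpos s).le
  simp only [mul_one, one_pow, one_mul, hclosed] at h
  have hL : 0 ≤ ∫ s in (0:ℝ)..1, g s :=
    intervalIntegral.integral_nonneg zero_le_one fun s _ => (hpos s).le
  nlinarith

/-- Uniform bound on the curvature. -/
theorem curvature_sq_le (hg : Continuous g) (hκ : ContDiff ℝ 1 κ) (hpos : ∀ s, 0 < g s)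
    (hclosed : (∫ s in (0:ℝ)..1, κ s * g s) = 2 * π)
    (hlen : (∫ s in (0:ℝ)..1, g s) ≤ M)
    (hcurv : (∫ s in (0:ℝ)..1, κ s ^ 2 * g s) ≤ M ^ 2)
    (htot : (∫ s in (0:ℝ)..1, (deriv κ s ^ 2 / g s + κ s ^ 2 * g s)) ≤ M ^ 2)
    {x : ℝ} (hx : x ∈ Set.Icc (0:ℝ) 1) :
    κ x ^ 2 ≤ M ^ 4 * (1 + M) := by
  have hκc := hκ.continuous
  have hκd := hκ.continuous_deriv le_rfl
  have hne : ∀ s, g s ≠ 0 := fun s => (hpos s).ne'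
  have hosc : ∀ y ∈ Set.Icc (0:ℝ) 1, κ x ^ 2 * g y ≤ κ y ^ 2 * g y + M ^ 2 * g y := by
    intro y hy
    have h1 := abs_sub_le_integral_abs_deriv_s1 (hκ.pow 2) hx hy
    have h2 : (∫ s in (0:ℝ)..1, |deriv (fun s => κ s ^ 2) s|) ≤
        ∫ s in (0:ℝ)..1, (deriv κ s ^ 2 / g s + κ s ^ 2 * g s) := by
      refine intervalIntegral.integral_mono_on zero_le_one
        (((hκ.pow 2).continuous_deriv le_rfl).abs.intervalIntegrable _ _)
        (Continuous.intervalIntegrable (by fun_prop (disch := assumption)) _ _) ?_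
      intro s _
      have hd : deriv (fun s => κ s ^ 2) s = 2 * κ s * deriv κ s := by
        rw [((hκ.differentiable one_ne_zero s).hasDerivAt.fun_pow 2).deriv]
        push_cast; ring
      have hgs := hpos s
      rw [hd, abs_le]
      have e1 : deriv κ s ^ 2 / g s + κ s ^ 2 * g s - 2 * κ s * deriv κ s =
          (deriv κ s - κ s * g s) ^ 2 / g s := by field_simp; ring
      have e2 : deriv κ s ^ 2 / g s + κ s ^ 2 * g s + 2 * κ s * deriv κ s =
          (deriv κ s + κ s * g s) ^ 2 / g s := by field_simp; ring
      have p1 : 0 ≤ (deriv κ s - κ s * g s) ^ 2 / g s := by positivity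
      have p2 : 0 ≤ (deriv κ s + κ s * g s) ^ 2 / g s := by positivity
      constructor <;> linarith
    have h3 := (le_abs_self _).trans (h1.trans (h2.trans htot))
    nlinarith [hpos y]
  have hint := intervalIntegral.integral_mono_on (μ := volume) zero_le_one
    (Continuous.intervalIntegrable (by fun_prop) _ _)
    (Continuous.intervalIntegrable (by fun_prop) _ _) hosc
  rw [intervalIntegral.integral_add
    (Continuous.intervalIntegrable (by fun_prop) _ _)
    (Continuous.intervalIntegrable (by fun_prop) _ _),
    intervalIntegral.integral_const_mul, intervalIntegral.integral_const_mul] at hint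
  have hlow := four_pi_sq_le_mul_length hg hκc hpos hclosed hcurv
  set L := ∫ s in (0:ℝ)..1, g s
  have hπ : 1 ≤ 4 * π ^ 2 := by nlinarith [pi_gt_three]
  calc κ x ^ 2 ≤ κ x ^ 2 * (M ^ 2 * L) :=
        le_mul_of_one_le_right (sq_nonneg _) (hπ.trans hlow)
    _ = M ^ 2 * (κ x ^ 2 * L) := by ring
    _ ≤ M ^ 2 * (M ^ 2 + M ^ 2 * M) := by
        refine mul_le_mul_of_nonneg_left ?_ (sq_nonneg M)
        nlinarith [mul_le_mul_of_nonneg_left hlen (sq_nonneg M)]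
    _ = M ^ 4 * (1 + M) := by ring

/-- Poincaré-type inequality: the energy `∫ (|∇ₛu|² + κ²u²) dσ` controls `∫ u² dσ`. -/
theorem integral_sq_le_energy (hM : 0 < M) (hg : Continuous g) (hκ : Continuous κ)
    (hpos : ∀ s, 0 < g s)
    (hclosed : (∫ s in (0:ℝ)..1, κ s * g s) = 2 * π)
    (hlen : (∫ s in (0:ℝ)..1, g s) ≤ M)
    (hcurv : (∫ s in (0:ℝ)..1, κ s ^ 2 * g s) ≤ M ^ 2)
    {u : ℝ → ℝ} (hu : ContDiff ℝ 1 u) :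
    (∫ s in (0:ℝ)..1, u s ^ 2 * g s) ≤ M ^ 2 * (1 + M ^ 3) *
      ((∫ s in (0:ℝ)..1, (1 / g s * deriv u s) ^ 2 * g s) +
        ∫ s in (0:ℝ)..1, (κ s * u s) ^ 2 * g s) := by
  have huc := hu.continuous
  have hud := hu.continuous_deriv le_rfl
  have hne : ∀ s, g s ≠ 0 := fun s => (hpos s).ne'
  have hg0 : ∀ s, 0 ≤ g s := fun s => (hpos s).le
  have hv : Continuous fun s => |1 / g s * deriv u s| := by fun_prop (disch := assumption)
  set L := ∫ s in (0:ℝ)..1, g s with hLdef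
  have hL : 0 ≤ L := intervalIntegral.integral_nonneg zero_le_one fun s _ => hg0 s
  set V := ∫ s in (0:ℝ)..1, (1 / g s * deriv u s) ^ 2 * g s
  set Q := ∫ s in (0:ℝ)..1, (κ s * u s) ^ 2 * g s
  have hV : 0 ≤ V := intervalIntegral.integral_nonneg zero_le_one
    fun s _ => mul_nonneg (sq_nonneg _) (hg0 s)
  have hQ : 0 ≤ Q := intervalIntegral.integral_nonneg zero_le_one
    fun s _ => mul_nonneg (sq_nonneg _) (hg0 s)
  have hosc : ∀ x ∈ Set.Icc (0:ℝ) 1, ∀ y ∈ Set.Icc (0:ℝ) 1, (u x - u y) ^ 2 ≤ L * V := by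
    intro x hx y hy
    have h1 := abs_sub_le_integral_abs_deriv_s1 hu hx hy
    have h2 := sq_integral_mul_mul_le (continuous_const (y := (1:ℝ))) hv hg hg0
    have e : (fun s => 1 * |1 / g s * deriv u s| * g s) = fun s => |deriv u s| := by
      funext s
      rw [abs_mul, abs_of_pos (one_div_pos.2 (hpos s))]
      field_simp [hne s]
    rw [e] at h2
    simp only [sq_abs, one_pow, one_mul] at h2
    rw [← sq_abs]
    exact (pow_le_pow_left₀ (abs_nonneg _) h1 2).trans h2
  have hpt : ∀ x ∈ Set.Icc (0:ℝ) 1, u x ^ 2 * g x ≤ (M * (1 + M ^ 3) * (V + Q)) * g x := by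
    intro x hx
    refine mul_le_mul_of_nonneg_right ?_ (hg0 x)
    have hd : Continuous fun s => u x - u s := by fun_prop
    have c1 := sq_integral_mul_mul_le hκ hd hg hg0
    have c2 := sq_integral_mul_mul_le (hκ.mul huc) (continuous_const (y := (1:ℝ))) hg hg0
    simp only [mul_one, one_pow, one_mul] at c2
    have hsplit : u x * (2 * π) = (∫ s in (0:ℝ)..1, κ s * u s * g s) +
        ∫ s in (0:ℝ)..1, κ s * (u x - u s) * g s := by
      rw [← hclosed, ← intervalIntegral.integral_const_mul, ← intervalIntegral.integral_add
        (Continuous.intervalIntegrable (by fun_prop) _ _)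
        (Continuous.intervalIntegrable (by fun_prop) _ _)]
      congr 1; funext s; ring
    have hD : (∫ s in (0:ℝ)..1, (u x - u s) ^ 2 * g s) ≤ L * V * L := by
      rw [hLdef, ← intervalIntegral.integral_const_mul]
      refine intervalIntegral.integral_mono_on zero_le_one
        (Continuous.intervalIntegrable (by fun_prop) _ _)
        (Continuous.intervalIntegrable (by fun_prop) _ _) ?_
      exact fun s hs => mul_le_mul_of_nonneg_right (hosc x hx s hs) (hg0 s)
    set A := ∫ s in (0:ℝ)..1, κ s * u s * g s
    set B := ∫ s in (0:ℝ)..1, κ s * (u x - u s) * g s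
    have hA : A ^ 2 ≤ Q * M := c2.trans (mul_le_mul_of_nonneg_left hlen hQ)
    have hB : B ^ 2 ≤ M ^ 2 * (M * V * M) := by
      refine c1.trans (mul_le_mul hcurv (hD.trans ?_) ?_ (sq_nonneg M))
      · gcongr
      · exact intervalIntegral.integral_nonneg zero_le_one
          fun s _ => mul_nonneg (sq_nonneg _) (hg0 s)
    have hAB : (u x * (2 * π)) ^ 2 ≤ 2 * (A ^ 2 + B ^ 2) := by
      rw [hsplit]; nlinarith [sq_nonneg (A - B)]
    have hπ : 2 * u x ^ 2 ≤ (u x * (2 * π)) ^ 2 := by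
      have : (2:ℝ) ≤ (2 * π) ^ 2 := by nlinarith [pi_gt_three]
      rw [mul_pow]; nlinarith [sq_nonneg (u x)]
    have n1 : 0 ≤ M * V := by positivity
    have n2 : 0 ≤ M ^ 4 * Q := by positivity
    nlinarith
  have hint := intervalIntegral.integral_mono_on (μ := volume) zero_le_one
    (Continuous.intervalIntegrable (by fun_prop) _ _)
    (Continuous.intervalIntegrable (by fun_prop) _ _) hpt
  rw [intervalIntegral.integral_const_mul] at hint
  refine hint.trans ?_
  have : 0 ≤ M * (1 + M ^ 3) * (V + Q) := by positivity
  calc M * (1 + M ^ 3) * (V + Q) * L ≤ M * (1 + M ^ 3) * (V + Q) * M :=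
        mul_le_mul_of_nonneg_left hlen this
    _ = _ := by ring

end Curve

/-- **H² coercivity of the Helmholtz operator.**
For every `M > 0` there is `ν₂ > 0`, depending only on `M`, such that for all 1-periodic
`C¹` data `(g, κ)` with `g > 0`, closure constraint `∫₀¹ κ g = 2π`, length bound
`∫₀¹ g ≤ M` and curvature bound `∫₀¹ (κ′²/g + κ²g) ≤ M²`, and for every 1-periodic `C²`
function `u`,
`∫₀¹ (H u)² g ≥ ν₂² ∫₀¹ (|∇ₛ∇ₛu|² + u²) g`, where `∇ₛ∇ₛu = (1/g)((1/g)u′)′` and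
`H u = −∇ₛ∇ₛu + κ²u`; that is, `‖H u‖_{L²(dσ)} ≥ ν₂ ‖u‖_{H²}`. -/
theorem helmholtz_H2_coercive (M : ℝ) (hM : 0 < M) :
    ∃ ν₂ : ℝ, 0 < ν₂ ∧
      ∀ g κ : ℝ → ℝ,
        Function.Periodic g 1 → Function.Periodic κ 1 →
        ContDiff ℝ 1 g → ContDiff ℝ 1 κ → (∀ s, 0 < g s) →
        (∫ s in (0:ℝ)..1, κ s * g s) = 2 * π →
        (∫ s in (0:ℝ)..1, g s) ≤ M →
        (∫ s in (0:ℝ)..1, ((deriv κ s) ^ 2 / g s + (κ s) ^ 2 * g s)) ≤ M ^ 2 →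
        ∀ u : ℝ → ℝ, Function.Periodic u 1 → ContDiff ℝ 2 u →
          ν₂ ^ 2 * ∫ s in (0:ℝ)..1,
              (((1 / g s) * deriv (fun t => (1 / g t) * deriv u t) s) ^ 2 + (u s) ^ 2) * g s ≤
            ∫ s in (0:ℝ)..1,
              (-((1 / g s) * deriv (fun t => (1 / g t) * deriv u t) s) + (κ s) ^ 2 * u s) ^ 2
                * g s := by
  set C := M ^ 2 * (1 + M ^ 3) with hC
  set K := M ^ 4 * (1 + M) with hK
  set D := (2 * K ^ 2 + 1) * C ^ 2 + 2 with hD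
  have hDpos : 0 < D := by positivity
  refine ⟨Real.sqrt (1 / D), by positivity, ?_⟩
  intro g κ pg _ hg hκ hpos hclosed hlen htot u pu hu
  rw [Real.sq_sqrt (by positivity)]
  have hne : ∀ s, g s ≠ 0 := fun s => (hpos s).ne'
  have hg0 : ∀ s, 0 ≤ g s := fun s => (hpos s).le
  have hgc := hg.continuous
  have hκc := hκ.continuous
  have hκd := hκ.continuous_deriv le_rfl
  have hu1 : ContDiff ℝ 1 u := hu.of_le one_le_two
  have huc := hu.continuous
  have hud : ContDiff ℝ 1 (deriv u) := by
    have h2 : ContDiff ℝ (1 + 1) u := by simpa [one_add_one_eq_two] using hu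
    exact (contDiff_succ_iff_deriv.1 h2).2.2
  have hudc := hud.continuous
  have hv : ContDiff ℝ 1 fun t => 1 / g t * deriv u t :=
    (contDiff_const.div hg hne).mul hud
  have hvd := hv.continuous_deriv le_rfl
  have pv : Function.Periodic (fun t => 1 / g t * deriv u t) 1 := fun t => by
    simp only [pg t, pu.deriv_periodic t]
  set w : ℝ → ℝ := fun s => 1 / g s * deriv (fun t => 1 / g t * deriv u t) s with hw
  have hwc : Continuous w := by
    rw [hw]; fun_prop (disch := assumption)
  have hcurv : (∫ s in (0:ℝ)..1, κ s ^ 2 * g s) ≤ M ^ 2 := by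
    refine le_trans (intervalIntegral.integral_mono_on zero_le_one
      (Continuous.intervalIntegrable (by fun_prop) _ _)
      (Continuous.intervalIntegrable (by fun_prop (disch := assumption)) _ _) ?_) htot
    intro s _
    have := div_nonneg (sq_nonneg (deriv κ s)) (hg0 s)
    linarith
  have hpoinc := integral_sq_le_energy hM hgc hκc hpos hclosed hlen hcurv hu1
  have hparts := integral_deriv_mul_eq_neg_of_periodic hu1 hv pu pv
  change 1 / D * (∫ s in (0:ℝ)..1, (w s ^ 2 + u s ^ 2) * g s) ≤
    ∫ s in (0:ℝ)..1, (-w s + κ s ^ 2 * u s) ^ 2 * g s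
  have henergy : (∫ s in (0:ℝ)..1, (-w s + κ s ^ 2 * u s) * u s * g s) =
      (∫ s in (0:ℝ)..1, (1 / g s * deriv u s) ^ 2 * g s) +
        ∫ s in (0:ℝ)..1, (κ s * u s) ^ 2 * g s := by
    have e1 : (fun s => (-w s + κ s ^ 2 * u s) * u s * g s) = fun s =>
        -(deriv (fun t => 1 / g t * deriv u t) s * u s) + (κ s * u s) ^ 2 * g s := by
      funext s
      have := hne s
      simp only [hw]
      field_simp
    have e2 : (fun s => (1 / g s * deriv u s) ^ 2 * g s) =
        fun s => 1 / g s * deriv u s * deriv u s := by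
      funext s
      have := hne s
      field_simp
    rw [e1, e2, intervalIntegral.integral_add
      (Continuous.intervalIntegrable (by fun_prop) _ _)
      (Continuous.intervalIntegrable (by fun_prop) _ _), intervalIntegral.integral_neg, hparts,
      neg_neg]
  rw [← henergy] at hpoinc
  have hcs := sq_integral_mul_mul_le (a := fun s => -w s + κ s ^ 2 * u s) (by fun_prop) huc hgc hg0
  have hsum : (∫ s in (0:ℝ)..1, (w s ^ 2 + u s ^ 2) * g s) ≤
      (2 * K ^ 2 + 1) * (∫ s in (0:ℝ)..1, u s ^ 2 * g s) +
        2 * ∫ s in (0:ℝ)..1, (-w s + κ s ^ 2 * u s) ^ 2 * g s := by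
    rw [← intervalIntegral.integral_const_mul, ← intervalIntegral.integral_const_mul,
      ← intervalIntegral.integral_add
      (Continuous.intervalIntegrable (by fun_prop) _ _)
      (Continuous.intervalIntegrable (by fun_prop) _ _)]
    refine intervalIntegral.integral_mono_on zero_le_one
      (Continuous.intervalIntegrable (by fun_prop) _ _)
      (Continuous.intervalIntegrable (by fun_prop) _ _) ?_
    intro s hs
    have hk := curvature_sq_le hgc hκ hpos hclosed hlen hcurv htot hs
    have hk2 : (κ s ^ 2) ^ 2 ≤ K ^ 2 := pow_le_pow_left₀ (sq_nonneg _) hk 2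
    have hk3 := mul_le_mul_of_nonneg_right hk2 (sq_nonneg (u s))
    have : w s ^ 2 + u s ^ 2 ≤
        (2 * K ^ 2 + 1) * u s ^ 2 + 2 * (-w s + κ s ^ 2 * u s) ^ 2 := by
      nlinarith [sq_nonneg (2 * (κ s ^ 2 * u s) - w s)]
    calc (w s ^ 2 + u s ^ 2) * g s ≤ _ := mul_le_mul_of_nonneg_right this (hg0 s)
      _ = _ := by ring
  have hU : 0 ≤ ∫ s in (0:ℝ)..1, u s ^ 2 * g s :=
    intervalIntegral.integral_nonneg zero_le_one fun s _ => mul_nonneg (sq_nonneg _) (hg0 s)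
  have hF : 0 ≤ ∫ s in (0:ℝ)..1, (-w s + κ s ^ 2 * u s) ^ 2 * g s :=
    intervalIntegral.integral_nonneg zero_le_one fun s _ => mul_nonneg (sq_nonneg _) (hg0 s)
  set U := ∫ s in (0:ℝ)..1, u s ^ 2 * g s
  set F := ∫ s in (0:ℝ)..1, (-w s + κ s ^ 2 * u s) ^ 2 * g s
  set E := ∫ s in (0:ℝ)..1, (-w s + κ s ^ 2 * u s) * u s * g s
  have hUF : U ≤ C ^ 2 * F := by
    rcases hU.eq_or_lt with h0 | h0
    · rw [← h0]; positivity
    · refine le_of_mul_le_mul_right ?_ h0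
      calc U * U = U ^ 2 := by ring
        _ ≤ (C * E) ^ 2 := pow_le_pow_left₀ hU hpoinc 2
        _ = C ^ 2 * E ^ 2 := by ring
        _ ≤ C ^ 2 * (F * U) := mul_le_mul_of_nonneg_left hcs (sq_nonneg C)
        _ = C ^ 2 * F * U := by ring
  rw [one_div, inv_mul_le_iff₀ hDpos]
  calc _ ≤ (2 * K ^ 2 + 1) * U + 2 * F := hsum
    _ ≤ (2 * K ^ 2 + 1) * (C ^ 2 * F) + 2 * F := by gcongr
    _ = D * F := by rw [hD]; ring
end

section
/- Let g, κ : ℝ → ℝ be 1-periodic with g continuous and strictly positive and κ continuous, satisfying the closure constraint ∫₀¹ κ(s) g(s) ds = 2π and the length bound ∫₀¹ g(s) ds ≤ M for some M > 0. Define the superlevel set S_κ = { s ∈ [0,1] : κ(s)² > 2π²/M² }. Then the curvature carries at least the mass ∫_{S_κ} κ(s)² g(s) ds ≥ 2π²/M over S_κ. -/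
open MeasureTheory Real

/-- **Curvature mass on its superlevel set.**
If `(g, κ)` is 1-periodic closed-curve data with `g` continuous and positive, `κ`
continuous, closure constraint `∫₀¹ κ g = 2π` and length bound `∫₀¹ g ≤ M`, then the
superlevel set `S_κ = {s ∈ [0,1] | κ(s)² > 2π²/M²}` carries the curvature mass
`∫_{S_κ} κ² g ds ≥ 2π²/M`. -/
theorem curvature_superlevel_mass (M : ℝ) (hM : 0 < M) (g κ : ℝ → ℝ)
    (hgper : Function.Periodic g 1) (hκper : Function.Periodic κ 1)
    (hgc : Continuous g) (hκc : Continuous κ) (hgpos : ∀ s, 0 < g s)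
    (hclose : (∫ s in (0:ℝ)..1, κ s * g s) = 2 * π)
    (hlen : (∫ s in (0:ℝ)..1, g s) ≤ M) :
    2 * π ^ 2 / M ≤
      ∫ s in {s : ℝ | s ∈ Set.Icc (0:ℝ) 1 ∧ 2 * π ^ 2 / M ^ 2 < (κ s) ^ 2},
        (κ s) ^ 2 * g s := by
  set c : ℝ := 2 * π ^ 2 / M ^ 2 with hc
  have hT : MeasurableSet {s : ℝ | c < (κ s) ^ 2} :=
    (isOpen_lt continuous_const (hκc.pow 2)).measurableSet
  have hS : {s : ℝ | s ∈ Set.Icc (0:ℝ) 1 ∧ c < (κ s) ^ 2} =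
      Set.Icc (0:ℝ) 1 ∩ {s : ℝ | c < (κ s) ^ 2} := rfl
  rw [hS, ← setIntegral_indicator hT]
  have hlower : (∫ s in Set.Icc (0:ℝ) 1, (4 * π / M * (κ s * g s) - 3 * c * g s)) ≤
      ∫ s in Set.Icc (0:ℝ) 1,
        {s : ℝ | c < (κ s) ^ 2}.indicator (fun s => (κ s) ^ 2 * g s) s := by
    apply integral_mono
    · exact Continuous.integrableOn_Icc (by fun_prop)
    · exact (Continuous.integrableOn_Icc (by fun_prop)).indicator hT
    · intro s
      have hsq : 4 * π / M * (κ s * g s) - 2 * c * g s ≤ (κ s) ^ 2 * g s := by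
        have h := mul_nonneg (sq_nonneg (κ s - 2 * π / M)) (hgpos s).le
        have e : (κ s - 2 * π / M) ^ 2 * g s =
            (κ s) ^ 2 * g s - (4 * π / M * (κ s * g s) - 2 * c * g s) := by
          rw [hc]; field_simp; ring
        linarith
      have hcg : 0 ≤ c * g s := mul_nonneg (by positivity) (hgpos s).le
      by_cases hs : c < (κ s) ^ 2
      · simp only [Set.indicator, Set.mem_ofPred_eq, hs, if_true]
        linarith
      · simp only [Set.indicator, Set.mem_ofPred_eq, hs, if_false]
        have := mul_le_mul_of_nonneg_right (not_lt.mp hs) (hgpos s).le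
        linarith
  refine le_trans ?_ hlower
  rw [integral_Icc_eq_integral_Ioc, ← intervalIntegral.integral_of_le zero_le_one,
    intervalIntegral.integral_sub (Continuous.intervalIntegrable (by fun_prop) _ _)
      (Continuous.intervalIntegrable (by fun_prop) _ _),
    intervalIntegral.integral_const_mul, intervalIntegral.integral_const_mul, hclose]
  have hcM : 3 * c * (∫ s in (0:ℝ)..1, g s) ≤ 3 * c * M :=
    mul_le_mul_of_nonneg_left hlen (by positivity)
  have e : 4 * π / M * (2 * π) - 3 * c * M = 2 * π ^ 2 / M := by
    rw [hc]; field_simp; ring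
  linarith
end

section
/- Let g : ℝ → ℝ be 1-periodic, continuous and strictly positive with total length L = ∫₀¹ g(s) ds, and let u : ℝ → ℝ be 1-periodic and C¹. Then for every s ∈ ℝ, u(s)² ≤ ( L⁻¹ ‖u‖_{L²(dσ)} + 2 ‖∇ₛu‖_{L²(dσ)} ) ‖u‖_{L²(dσ)}, where ‖u‖²_{L²(dσ)} = ∫₀¹ u²g ds and ‖∇ₛu‖²_{L²(dσ)} = ∫₀¹ u′²/g ds. -/
open MeasureTheory Real

/-- Weighted Cauchy–Schwarz inequality for continuous functions on an interval. -/
theorem intervalIntegral_abs_mul_le_sqrt_mul_sqrt {a b : ℝ} (hab : a ≤ b) {f h w : ℝ → ℝ}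
    (hf : Continuous f) (hh : Continuous h) (hw : Continuous w) (hpos : ∀ t, 0 < w t) :
    ∫ t in a..b, |f t * h t| ≤
      √(∫ t in a..b, f t ^ 2 * w t) * √(∫ t in a..b, h t ^ 2 / w t) := by
  have hdiv : Continuous fun t => h t ^ 2 / w t := (hh.pow 2).div hw fun t => (hpos t).ne'
  have hquad (x : ℝ) : 0 ≤ (∫ t in a..b, f t ^ 2 * w t) * (x * x)
      + (-2 * ∫ t in a..b, |f t * h t|) * x + ∫ t in a..b, h t ^ 2 / w t := by
    have hnonneg : 0 ≤ ∫ t in a..b,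
        (f t ^ 2 * w t * (x * x) + |f t * h t| * (-2 * x) + h t ^ 2 / w t) := by
      refine intervalIntegral.integral_nonneg hab fun t _ => ?_
      have hsq : f t ^ 2 * w t * (x * x) + |f t * h t| * (-2 * x) + h t ^ 2 / w t
          = (x * |f t| * w t - |h t|) ^ 2 / w t := by
        have := (hpos t).ne'
        rw [abs_mul, ← sq_abs (f t), ← sq_abs (h t)]
        field_simp
        ring
      rw [hsq]
      exact div_nonneg (sq_nonneg _) (hpos t).le
    have hfi : Continuous fun t => f t ^ 2 * w t * (x * x) := by fun_prop
    have hmi : Continuous fun t => |f t * h t| * (-2 * x) := by fun_prop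
    rw [intervalIntegral.integral_add ((hfi.fun_add hmi).intervalIntegrable _ _)
      (hdiv.intervalIntegrable _ _), intervalIntegral.integral_add (hfi.intervalIntegrable _ _)
      (hmi.intervalIntegrable _ _), intervalIntegral.integral_mul_const,
      intervalIntegral.integral_mul_const] at hnonneg
    linarith
  have hdiscrim := discrim_le_zero hquad
  have hA : 0 ≤ ∫ t in a..b, f t ^ 2 * w t :=
    intervalIntegral.integral_nonneg hab fun t _ => mul_nonneg (sq_nonneg _) (hpos t).le
  rw [← Real.sqrt_mul hA]
  refine Real.le_sqrt_of_sq_le ?_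
  rw [discrim] at hdiscrim
  linarith

/-- The oscillation of `u ^ 2` on an interval is at most twice the integral of `|u * u'|`. -/
theorem sq_le_sq_add_integral_abs_mul_deriv {a b : ℝ} {u : ℝ → ℝ} (hu : ContDiff ℝ 1 u)
    {s t : ℝ} (hs : s ∈ Set.Icc a b) (ht : t ∈ Set.Icc a b) :
    u s ^ 2 ≤ u t ^ 2 + 2 * ∫ r in a..b, |u r * deriv u r| := by
  have hab : a ≤ b := hs.1.trans hs.2
  have hc : Continuous fun r => u r * deriv u r :=
    hu.continuous.mul (hu.continuous_deriv le_rfl)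
  have hftc : ∫ r in t..s, 2 * (u r * deriv u r) = u s ^ 2 - u t ^ 2 := by
    refine intervalIntegral.integral_eq_sub_of_hasDerivAt (f := fun r => u r ^ 2)
      (fun r _ => ?_) ((hc.const_mul 2).intervalIntegrable _ _)
    exact ((hu.differentiable one_ne_zero r).hasDerivAt.fun_pow 2).congr_deriv (by simp [mul_assoc])
  rw [intervalIntegral.integral_const_mul] at hftc
  have hle : |∫ r in t..s, u r * deriv u r| ≤ ∫ r in a..b, |u r * deriv u r| := by
    rw [← Real.norm_eq_abs]
    refine intervalIntegral.norm_integral_le_abs_integral_norm.trans ?_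
    simp only [Real.norm_eq_abs]
    rw [← abs_of_nonneg (intervalIntegral.integral_nonneg hab
      fun r _ => abs_nonneg (u r * deriv u r))]
    refine intervalIntegral.abs_integral_mono_interval ?_
      (Filter.Eventually.of_forall fun r => abs_nonneg _) (hc.abs.intervalIntegrable _ _)
    rw [Set.uIoc_of_le hab]
    exact Set.Ioc_subset_Ioc (le_min ht.1 hs.1) (max_le ht.2 hs.2)
  linarith [le_abs_self (∫ r in t..s, u r * deriv u r)]

/-- **Sup-norm (Agmon-type) bound on a closed curve.**
For a 1-periodic, continuous, positive metric `g` with length `L = ∫₀¹ g` and a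
1-periodic `C¹` function `u`, every value satisfies
`u(s)² ≤ (L⁻¹‖u‖_{L²(dσ)} + 2‖∇ₛu‖_{L²(dσ)})‖u‖_{L²(dσ)}`, where
`‖u‖²_{L²(dσ)} = ∫₀¹ u²g` and `‖∇ₛu‖²_{L²(dσ)} = ∫₀¹ u′²/g`. -/
theorem sup_bound_on_curve (g u : ℝ → ℝ)
    (hgper : Function.Periodic g 1) (hgc : Continuous g) (hgpos : ∀ s, 0 < g s)
    (huper : Function.Periodic u 1) (hu : ContDiff ℝ 1 u) :
    ∀ s : ℝ,
      (u s) ^ 2 ≤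
        ((∫ t in (0:ℝ)..1, g t)⁻¹ * Real.sqrt (∫ t in (0:ℝ)..1, (u t) ^ 2 * g t) +
            2 * Real.sqrt (∫ t in (0:ℝ)..1, (deriv u t) ^ 2 / g t)) *
          Real.sqrt (∫ t in (0:ℝ)..1, (u t) ^ 2 * g t) := by
  intro s
  obtain ⟨y, hy, hsy⟩ := huper.exists_mem_Ico₀ one_pos s
  rw [hsy]
  have huc := hu.continuous
  have hcs := intervalIntegral_abs_mul_le_sqrt_mul_sqrt zero_le_one huc
    (hu.continuous_deriv le_rfl) hgc hgpos
  have hL : 0 < ∫ t in (0:ℝ)..1, g t :=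
    intervalIntegral.intervalIntegral_pos_of_pos (hgc.intervalIntegrable _ _) hgpos one_pos
  have hA : 0 ≤ ∫ t in (0:ℝ)..1, u t ^ 2 * g t :=
    intervalIntegral.integral_nonneg zero_le_one fun t _ => mul_nonneg (sq_nonneg _) (hgpos t).le
  set K := ∫ r in (0:ℝ)..1, |u r * deriv u r|
  have hug : Continuous fun t => u t ^ 2 * g t := by fun_prop
  have havg : u y ^ 2 * ∫ t in (0:ℝ)..1, g t ≤
      (∫ t in (0:ℝ)..1, u t ^ 2 * g t) + 2 * K * ∫ t in (0:ℝ)..1, g t := by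
    rw [← intervalIntegral.integral_const_mul, ← intervalIntegral.integral_const_mul,
      ← intervalIntegral.integral_add (hug.intervalIntegrable _ _)
        ((hgc.const_mul _).intervalIntegrable _ _)]
    refine intervalIntegral.integral_mono_on zero_le_one
      ((hgc.const_mul _).intervalIntegrable _ _)
      ((hug.add (hgc.const_mul _)).intervalIntegrable _ _) fun t ht => ?_
    rw [← add_mul]
    exact mul_le_mul_of_nonneg_right
      (sq_le_sq_add_integral_abs_mul_deriv hu (Set.Ico_subset_Icc_self hy) ht) (hgpos t).le
  have hdiv : u y ^ 2 ≤ (∫ t in (0:ℝ)..1, g t)⁻¹ * (∫ t in (0:ℝ)..1, u t ^ 2 * g t) + 2 * K := by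
    rw [inv_mul_eq_div, ← sub_le_iff_le_add, le_div_iff₀ hL]
    linarith
  rw [add_mul, mul_assoc, Real.mul_self_sqrt hA]
  linarith
end

section
/- Let g : ℝ → ℝ be 1-periodic, C¹ and strictly positive, κ : ℝ → ℝ be 1-periodic and continuous, and let w : ℝ → ℝ be 1-periodic and continuous. Suppose z : ℝ → ℝ is 1-periodic and C² and solves the Helmholtz problem −(1/g)((1/g)z′)′ + κ²z = κw pointwise. Then ∫₀¹ ( z′(s)²/g(s) + κ(s)²z(s)²g(s) ) ds ≤ ∫₀¹ w(s)²g(s) ds, and consequently the quadratic form of the incompressibility operator is nonnegative: ∫₀¹ ( w(s) − κ(s)z(s) ) w(s) g(s) ds ≥ 0. -/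
open MeasureTheory Real

/-- Multiplying the Helmholtz equation by `z g` and integrating over a period gives zero. -/
theorem integral_helmholtz_energy_eq_zero {g κ w z : ℝ → ℝ}
    (hgper : Function.Periodic g 1) (hg : ContDiff ℝ 1 g) (hgpos : ∀ s, 0 < g s)
    (hκc : Continuous κ) (hwc : Continuous w)
    (hzper : Function.Periodic z 1) (hz : ContDiff ℝ 2 z)
    (hsol : ∀ s,
      -((1 / g s) * deriv (fun t => (1 / g t) * deriv z t) s) + (κ s) ^ 2 * z s
        = κ s * w s) :
    ∫ s in (0:ℝ)..1,
      ((deriv z s) ^ 2 / g s + (κ s) ^ 2 * (z s) ^ 2 * g s - κ s * w s * z s * g s) = 0 := by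
  have hg0 : ∀ s, g s ≠ 0 := fun s => (hgpos s).ne'
  have hgc : Continuous g := hg.continuous
  have hzc : Continuous z := hz.continuous
  have hz' : ContDiff ℝ 1 (deriv z) := hz.deriv' (n := 1)
  have hz'c : Continuous (deriv z) := hz'.continuous
  have hflux : Differentiable ℝ (fun t => (1 / g t) * deriv z t) :=
    ((contDiff_const.div hg hg0).mul hz').differentiable one_ne_zero
  have hF : ∀ s, HasDerivAt (fun t => ((1 / g t) * deriv z t) * z t)
      ((deriv z s) ^ 2 / g s + (κ s) ^ 2 * (z s) ^ 2 * g s - κ s * w s * z s * g s) s := by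
    intro s
    have hd := (hflux s).hasDerivAt.mul ((hz.differentiable two_ne_zero) s).hasDerivAt
    refine hd.congr_deriv ?_
    have h := hsol s
    generalize deriv (fun t => (1 / g t) * deriv z t) s = p at h ⊢
    have hp : p = g s * ((κ s) ^ 2 * z s - κ s * w s) := by
      have := hg0 s
      field_simp at h
      linear_combination -h
    rw [hp]
    ring
  have hz'per : deriv z 1 = deriv z 0 := by
    have h := deriv_comp_add_const z 1 0
    rw [show (fun x => z (x + 1)) = z from funext hzper, zero_add] at h
    exact h.symm
  have hz1 : z 1 = z 0 := by simpa using hzper 0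
  have hg1 : g 1 = g 0 := by simpa using hgper 0
  rw [intervalIntegral.integral_eq_sub_of_hasDerivAt (fun s _ => hF s), hz'per, hz1, hg1, sub_self]
  refine Continuous.intervalIntegrable ?_ _ _
  exact (((hz'c.pow 2).div hgc hg0).add (((hκc.pow 2).mul (hzc.pow 2)).mul hgc)).sub
    (((hκc.mul hwc).mul hzc).mul hgc)

/-- **Energy bound for the Helmholtz problem and nonnegativity of the
incompressibility form.**
Let `g` be 1-periodic, `C¹` and positive, `κ` and `w` 1-periodic and continuous, and let
`z` be a 1-periodic `C²` solution of the Helmholtz problem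
`−(1/g)((1/g)z′)′ + κ²z = κw`. Then `∫₀¹ (z′²/g + κ²z²g) ≤ ∫₀¹ w²g`, and the quadratic
form of the incompressibility operator `𝓘 = Id − κH⁻¹(κ·)` is nonnegative:
`∫₀¹ (w − κz)w g ≥ 0`. -/
theorem incompressibility_form_nonneg (g κ w z : ℝ → ℝ)
    (hgper : Function.Periodic g 1) (hg : ContDiff ℝ 1 g) (hgpos : ∀ s, 0 < g s)
    (hκper : Function.Periodic κ 1) (hκc : Continuous κ)
    (hwper : Function.Periodic w 1) (hwc : Continuous w)
    (hzper : Function.Periodic z 1) (hz : ContDiff ℝ 2 z)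
    (hsol : ∀ s,
      -((1 / g s) * deriv (fun t => (1 / g t) * deriv z t) s) + (κ s) ^ 2 * z s
        = κ s * w s) :
    (∫ s in (0:ℝ)..1, ((deriv z s) ^ 2 / g s + (κ s) ^ 2 * (z s) ^ 2 * g s)) ≤
        (∫ s in (0:ℝ)..1, (w s) ^ 2 * g s) ∧
      0 ≤ ∫ s in (0:ℝ)..1, (w s - κ s * z s) * w s * g s := by
  have hg0 : ∀ s, g s ≠ 0 := fun s => (hgpos s).ne'
  have hgc : Continuous g := hg.continuous
  have hzc : Continuous z := hz.continuous
  have hz'c : Continuous (deriv z) := (hz.deriv' (n := 1)).continuous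
  have hE := integral_helmholtz_energy_eq_zero hgper hg hgpos hκc hwc hzper hz hsol
  have hEc : Continuous fun s => (deriv z s) ^ 2 / g s + (κ s) ^ 2 * (z s) ^ 2 * g s :=
    ((hz'c.pow 2).div hgc hg0).add (((hκc.pow 2).mul (hzc.pow 2)).mul hgc)
  have hBc : Continuous fun s => κ s * w s * z s * g s := by fun_prop
  have hAc : Continuous fun s => (w s) ^ 2 * g s := by fun_prop
  rw [intervalIntegral.integral_sub (hEc.intervalIntegrable _ _)
    (hBc.intervalIntegrable _ _)] at hE
  have hAB : (∫ s in (0:ℝ)..1, (w s - κ s * z s) * w s * g s) =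
      (∫ s in (0:ℝ)..1, (w s) ^ 2 * g s) - ∫ s in (0:ℝ)..1, κ s * w s * z s * g s := by
    rw [← intervalIntegral.integral_sub (hAc.intervalIntegrable _ _)
      (hBc.intervalIntegrable _ _)]
    congr 1
    ext s
    ring
  have hsq : (∫ s in (0:ℝ)..1, 2 * (κ s * w s * z s * g s)) ≤
      ∫ s in (0:ℝ)..1, ((w s) ^ 2 * g s +
        ((deriv z s) ^ 2 / g s + (κ s) ^ 2 * (z s) ^ 2 * g s)) := by
    refine intervalIntegral.integral_mono zero_le_one
      ((continuous_const.mul hBc).intervalIntegrable _ _)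
      ((hAc.add hEc).intervalIntegrable _ _) fun s => ?_
    have h1 : 0 ≤ (w s - κ s * z s) ^ 2 * g s := mul_nonneg (sq_nonneg _) (hgpos s).le
    have h2 : 0 ≤ (deriv z s) ^ 2 / g s := div_nonneg (sq_nonneg _) (hgpos s).le
    dsimp only
    linarith
  rw [intervalIntegral.integral_const_mul, intervalIntegral.integral_add
    (hAc.intervalIntegrable _ _) (hEc.intervalIntegrable _ _)] at hsq
  rw [hAB]
  constructor <;> linarith
end
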